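/- Suppose the plus-connected occupied component C⁺(0) containing the origin is finite and nonempty. Then the outermost boundary ∂⁺0 of C⁺(0) is a unique cycle C⁺_out in G⁺_C with the following properties: (i) all squares of C⁺(0) are contained in the interior of C⁺_out; (ii) every edge of C⁺_out is a boundary edge adjacent to an occupied square of C⁺(0) lying in the interior of C⁺_out and to a vacant square lying in the exterior of C⁺_out. -/

import Mathlib

/-!
Common framework: tile ℝ² into closed unit squares indexed by `ℤ²`, with corners
forming a translate of `ℤ²` and the origin the centre of the square `S₀` (index `(0,0)`).
A cycle is identified with its edge set (a set of unordered pairs of corners);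
its interior (resp. exterior) is the union of the bounded (resp. unbounded)
connected components of the complement of the closed curve it traces in the plane.
-/

/-- Corners of the grid squares, indexed by `ℤ²`. -/
abbrev GridV := ℤ × ℤ

/-- Embedding of corners into the plane: the square of index `z` is
`[z₁ - 1/2, z₁ + 1/2] × [z₂ - 1/2, z₂ + 1/2]`, so the origin is the centre of `S₀`. -/
noncomputable def toPlane (v : GridV) : ℝ × ℝ := ((v.1 : ℝ) - 1 / 2, (v.2 : ℝ) - 1 / 2)

/-- The closed unit square of index `z`. -/
def squareSet (z : GridV) : Set (ℝ × ℝ) :=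
  Set.Icc ((z.1 : ℝ) - 1 / 2, (z.2 : ℝ) - 1 / 2) ((z.1 : ℝ) + 1 / 2, (z.2 : ℝ) + 1 / 2)

/-- The four edges (unit segments) of the square of index `z`, as unordered pairs of corners. -/
def squareEdges (z : GridV) : Set (Sym2 GridV) :=
  {s(z, z + (1, 0)), s(z + (1, 0), z + (1, 1)), s(z + (1, 1), z + (0, 1)), s(z + (0, 1), z)}

/-- Adjacency of corners in the full grid graph `G`: Euclidean distance one. -/
def GridAdj (u v : GridV) : Prop := |u.1 - v.1| + |u.2 - v.2| = 1

/-- A cycle in the full grid graph: a cyclic sequence `(v₀, …, v_{n-1}, v₀)` of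
distinct corners with consecutive corners adjacent. -/
structure GridCycle where
  n : ℕ
  hn : 3 ≤ n
  f : ZMod n → GridV
  inj : Function.Injective f
  adj : ∀ i, GridAdj (f i) (f (i + 1))

/-- The edge set of a grid cycle. -/
def GridCycle.edgeSet (C : GridCycle) : Set (Sym2 GridV) :=
  {e | ∃ i : ZMod C.n, e = s(C.f i, C.f (i + 1))}

/-- An edge set is (the edge set of) a cycle of the grid graph `G`.
We identify a cycle with its edge set. -/
def IsCycle (E : Set (Sym2 GridV)) : Prop := ∃ C : GridCycle, C.edgeSet = E

/-- A cycle of the subgraph of the grid graph with edge set `G`. -/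
def IsCycleIn (G E : Set (Sym2 GridV)) : Prop := IsCycle E ∧ E ⊆ G

/-- The vertices incident to some edge of `E`. -/
def vertexSetOf (E : Set (Sym2 GridV)) : Set GridV := {v | ∃ e ∈ E, v ∈ e}

/-- The closed segment in the plane realizing an edge. -/
noncomputable def edgeSeg : Sym2 GridV → Set (ℝ × ℝ) :=
  Sym2.lift ⟨fun a b => segment ℝ (toPlane a) (toPlane b), fun _ _ => segment_symm ℝ _ _⟩

/-- The closed curve in the plane traced by the edges of `E`. -/
noncomputable def carrierOf (E : Set (Sym2 GridV)) : Set (ℝ × ℝ) := ⋃ e ∈ E, edgeSeg e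

/-- The interior of a cycle: the union of the bounded connected components of the
complement of its carrier curve. -/
noncomputable def interiorOf (E : Set (Sym2 GridV)) : Set (ℝ × ℝ) :=
  {p | p ∉ carrierOf E ∧ Bornology.IsBounded (connectedComponentIn (carrierOf E)ᶜ p)}

/-- The exterior of a cycle: the union of the unbounded connected components of the
complement of its carrier curve. -/
noncomputable def exteriorOf (E : Set (Sym2 GridV)) : Set (ℝ × ℝ) :=
  {p | p ∉ carrierOf E ∧ ¬ Bornology.IsBounded (connectedComponentIn (carrierOf E)ᶜ p)}

/-- The set `A` is contained in the interior of the cycle `E` (points of the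
curve itself being allowed, so that e.g. a square whose boundary edges lie on the
cycle counts as contained in the interior). -/
def inInterior (E : Set (Sym2 GridV)) (A : Set (ℝ × ℝ)) : Prop :=
  A ⊆ interiorOf E ∪ carrierOf E

/-- The set `A` lies in the exterior of the cycle `E` (points of the curve itself
being allowed). -/
def inExterior (E : Set (Sym2 GridV)) (A : Set (ℝ × ℝ)) : Prop :=
  A ⊆ exteriorOf E ∪ carrierOf E

/-- Star adjacency: distinct squares sharing at least a corner. -/
def starAdj (z w : GridV) : Prop := z ≠ w ∧ |z.1 - w.1| ≤ 1 ∧ |z.2 - w.2| ≤ 1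

/-- Plus adjacency: squares sharing an edge. -/
def plusAdj (z w : GridV) : Prop := |z.1 - w.1| + |z.2 - w.2| = 1

/-- The star-connected occupied component `C(0)` of the square `S₀` (of index `(0,0)`),
for the occupancy configuration `ω`; empty if `S₀` is vacant. -/
def starComp (ω : GridV → Prop) : Set GridV :=
  {z | ω z ∧ Relation.ReflTransGen (fun a b => ω a ∧ ω b ∧ starAdj a b) (0, 0) z}

/-- The plus-connected occupied component `C⁺(0)` of the square `S₀`. -/
def plusComp (ω : GridV → Prop) : Set GridV :=
  {z | ω z ∧ Relation.ReflTransGen (fun a b => ω a ∧ ω b ∧ plusAdj a b) (0, 0) z}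

/-- The edge set of the graph `G_C`: all edges of squares of `C(0)`. -/
def gcEdges (ω : GridV → Prop) : Set (Sym2 GridV) := ⋃ z ∈ starComp ω, squareEdges z

/-- The edge set of the graph `G⁺_C`: all edges of squares of `C⁺(0)`. -/
def gpcEdges (ω : GridV → Prop) : Set (Sym2 GridV) := ⋃ z ∈ plusComp ω, squareEdges z

/-- `e` is an outermost boundary edge of the graph with edge set `G`: for every
cycle `E` in this graph, either `e` is an edge of `E` or `e` lies in the exterior of `E`. -/
def outermostBoundaryEdgeIn (G : Set (Sym2 GridV)) (e : Sym2 GridV) : Prop :=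
  e ∈ G ∧ ∀ E, IsCycleIn G E → e ∈ E ∨ inExterior E (edgeSeg e)

/-- The subgraph spanned by the edge set `E` is connected: any two incident vertices
are joined by a walk using only edges of `E`. -/
def EdgeSetConnected (E : Set (Sym2 GridV)) : Prop :=
  ∀ u v, u ∈ vertexSetOf E → v ∈ vertexSetOf E →
    ∃ p : List GridV, p.head? = some u ∧ p.getLast? = some v ∧
      List.Chain' (fun a b => s(a, b) ∈ E) p

/-- `D` is the outermost boundary cycle `D_k` of the square of index `z` of the star
component `C(0)`: (a) the square lies in the interior of `D`; (b) every edge of `D` is a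
boundary edge adjacent to an occupied square of `C(0)` in the interior of `D` and to a
vacant square in the exterior of `D`; (c) every cycle of `G_C` containing the square in
its interior has all its edges on `D` or in the interior of `D`. -/
def isOutermostCycleOf (ω : GridV → Prop) (z : GridV) (D : Set (Sym2 GridV)) : Prop :=
  IsCycleIn (gcEdges ω) D ∧
  inInterior D (squareSet z) ∧
  (∀ e ∈ D,
    (∃ w ∈ starComp ω, e ∈ squareEdges w ∧ inInterior D (squareSet w)) ∧
    (∃ w, ¬ ω w ∧ e ∈ squareEdges w ∧ inExterior D (squareSet w))) ∧
  (∀ C, IsCycleIn (gcEdges ω) C → inInterior C (squareSet z) →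
    ∀ e ∈ C, e ∈ D ∨ inInterior D (edgeSeg e))

/-- The list of edges traversed by a walk given as a list of vertices. -/
def walkEdges (p : List GridV) : List (Sym2 GridV) :=
  List.zipWith (fun a b => s(a, b)) p p.tail

/-- The horizontal edge with left endpoint `u`. -/
def hEdge (u : GridV) : Sym2 GridV := s(u, u + (1, 0))

/-- The vertical edge with lower endpoint `u`. -/
def vEdge (u : GridV) : Sym2 GridV := s(u, u + (0, 1))

/-- The centre of the square of index `z`. -/
def squareCenter (z : GridV) : ℝ × ℝ := ((z.1 : ℝ), (z.2 : ℝ))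

/-- The edges separating a square of `S` from a square outside `S`. -/
def cellBoundary (S : Set GridV) : Set (Sym2 GridV) :=
  {e | ∃ a ∈ S, ∃ b, b ∉ S ∧ e ∈ squareEdges a ∧ e ∈ squareEdges b}

/-! ### Edges of the grid -/

lemma hEdge_inj {u v : GridV} : hEdge u = hEdge v ↔ u = v := by
  obtain ⟨a, b⟩ := u
  obtain ⟨c, d⟩ := v
  simp only [hEdge, Sym2.eq_iff, Prod.mk_add_mk, Prod.mk.injEq]
  omega

lemma vEdge_inj {u v : GridV} : vEdge u = vEdge v ↔ u = v := by
  obtain ⟨a, b⟩ := u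
  obtain ⟨c, d⟩ := v
  simp only [vEdge, Sym2.eq_iff, Prod.mk_add_mk, Prod.mk.injEq]
  omega

lemma hEdge_ne_vEdge (u v : GridV) : hEdge u ≠ vEdge v := by
  obtain ⟨a, b⟩ := u
  obtain ⟨c, d⟩ := v
  simp only [hEdge, vEdge, ne_eq, Sym2.eq_iff, Prod.mk_add_mk, Prod.mk.injEq]
  omega

lemma mem_squareEdges {z : GridV} {e : Sym2 GridV} :
    e ∈ squareEdges z ↔
      e = hEdge z ∨ e = vEdge (z + (1, 0)) ∨ e = hEdge (z + (0, 1)) ∨ e = vEdge z := by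
  have h1 : z + (1, 1) = z + (1, 0) + (0, 1) := by ext <;> simp
  have h2 : z + (1, 1) = z + (0, 1) + (1, 0) := by ext <;> simp
  simp only [squareEdges, hEdge, vEdge, Set.mem_insert_iff, Set.mem_singleton_iff]
  rw [Sym2.eq_swap (a := z + (1, 1)), Sym2.eq_swap (a := z + (0, 1)) (b := z), ← h1, ← h2]

lemma hEdge_mem_squareEdges {u z : GridV} :
    hEdge u ∈ squareEdges z ↔ z = u ∨ z = u - (0, 1) := by
  simp only [mem_squareEdges, hEdge_inj, hEdge_ne_vEdge, false_or, or_false, eq_sub_iff_add_eq]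
  tauto

lemma vEdge_mem_squareEdges {u z : GridV} :
    vEdge u ∈ squareEdges z ↔ z = u ∨ z = u - (1, 0) := by
  simp only [mem_squareEdges, vEdge_inj, (hEdge_ne_vEdge _ _).symm, false_or, eq_sub_iff_add_eq]
  tauto

lemma eq_hEdge_or_eq_vEdge {z : GridV} {e : Sym2 GridV} (h : e ∈ squareEdges z) :
    (∃ u, e = hEdge u) ∨ ∃ u, e = vEdge u := by
  rcases mem_squareEdges.1 h with h | h | h | h
  exacts [.inl ⟨_, h⟩, .inr ⟨_, h⟩, .inl ⟨_, h⟩, .inr ⟨_, h⟩]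

lemma GridAdj.cases {u v : GridV} (h : GridAdj u v) :
    v = u + (1, 0) ∨ v = u - (1, 0) ∨ v = u + (0, 1) ∨ v = u - (0, 1) := by
  obtain ⟨a, b⟩ := u
  obtain ⟨c, d⟩ := v
  simp only [GridAdj, Prod.mk_add_mk, Prod.mk_sub_mk, Prod.mk.injEq] at h ⊢
  have h1 := abs_cases (a - c)
  have h2 := abs_cases (b - d)
  omega

lemma gridAdj_of_mem_squareEdges {z u v : GridV} (h : s(u, v) ∈ squareEdges z) :
    GridAdj u v := by
  obtain ⟨a, b⟩ := u
  obtain ⟨c, d⟩ := v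
  obtain ⟨x, y⟩ := z
  simp only [mem_squareEdges, hEdge, vEdge, Sym2.eq_iff, Prod.mk_add_mk, Prod.mk.injEq] at h
  simp only [GridAdj]
  have h1 := abs_cases (a - c)
  have h2 := abs_cases (b - d)
  omega

lemma plusAdj.symm {a b : GridV} (h : plusAdj a b) : plusAdj b a := by
  unfold plusAdj at *
  rwa [abs_sub_comm, abs_sub_comm b.2]

lemma plusAdj.exists_edge {a b : GridV} (h : plusAdj a b) :
    ∃ e, e ∈ squareEdges a ∧ e ∈ squareEdges b := by
  rcases GridAdj.cases h with rfl | rfl | rfl | rfl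
  · exact ⟨vEdge (a + (1, 0)), by simp [vEdge_mem_squareEdges]⟩
  · exact ⟨vEdge a, by simp [vEdge_mem_squareEdges]⟩
  · exact ⟨hEdge (a + (0, 1)), by simp [hEdge_mem_squareEdges]⟩
  · exact ⟨hEdge a, by simp [hEdge_mem_squareEdges]⟩

lemma plusAdj_sub_one_zero (u : GridV) : plusAdj u (u - (1, 0)) := by simp [plusAdj]

lemma plusAdj_sub_zero_one (u : GridV) : plusAdj u (u - (0, 1)) := by simp [plusAdj]

/-- Two distinct squares with a common edge `e`. -/
lemma common_edge_cases {a b : GridV} {e : Sym2 GridV} (hab : a ≠ b)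
    (ha : e ∈ squareEdges a) (hb : e ∈ squareEdges b) :
    ∃ u, (e = hEdge u ∧ (a = u ∧ b = u - (0, 1) ∨ a = u - (0, 1) ∧ b = u)) ∨
      (e = vEdge u ∧ (a = u ∧ b = u - (1, 0) ∨ a = u - (1, 0) ∧ b = u)) := by
  rcases eq_hEdge_or_eq_vEdge ha with ⟨u, rfl⟩ | ⟨u, rfl⟩
  · rw [hEdge_mem_squareEdges] at ha hb
    refine ⟨u, .inl ⟨rfl, ?_⟩⟩
    grind
  · rw [vEdge_mem_squareEdges] at ha hb
    refine ⟨u, .inr ⟨rfl, ?_⟩⟩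
    grind

lemma plusAdj_of_common_edge {a b : GridV} {e : Sym2 GridV} (hab : a ≠ b)
    (ha : e ∈ squareEdges a) (hb : e ∈ squareEdges b) : plusAdj a b := by
  obtain ⟨u, ⟨-, ⟨rfl, rfl⟩ | ⟨rfl, rfl⟩⟩ | ⟨-, ⟨rfl, rfl⟩ | ⟨rfl, rfl⟩⟩⟩ :=
    common_edge_cases hab ha hb
  exacts [plusAdj_sub_zero_one _, (plusAdj_sub_zero_one _).symm, plusAdj_sub_one_zero _,
    (plusAdj_sub_one_zero _).symm]

/-- A common edge of two squares is incident to no other square. -/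
lemma eq_or_eq_of_common_edge {a b c : GridV} {e : Sym2 GridV} (hab : a ≠ b)
    (ha : e ∈ squareEdges a) (hb : e ∈ squareEdges b) (hc : e ∈ squareEdges c) :
    c = a ∨ c = b := by
  obtain ⟨u, ⟨rfl, h⟩ | ⟨rfl, h⟩⟩ := common_edge_cases hab ha hb
  · rw [hEdge_mem_squareEdges] at hc
    grind
  · rw [vEdge_mem_squareEdges] at hc
    grind

lemma hEdge_mem_cellBoundary {S : Set GridV} {u : GridV} :
    hEdge u ∈ cellBoundary S ↔ ¬ (u ∈ S ↔ u - (0, 1) ∈ S) := by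
  simp only [cellBoundary, hEdge_mem_squareEdges, Set.mem_ofPred_eq]
  grind

lemma vEdge_mem_cellBoundary {S : Set GridV} {u : GridV} :
    vEdge u ∈ cellBoundary S ↔ ¬ (u ∈ S ↔ u - (1, 0) ∈ S) := by
  simp only [cellBoundary, vEdge_mem_squareEdges, Set.mem_ofPred_eq]
  grind

/-! ### Squares and edges in the plane -/

lemma mem_squareSet {z : GridV} {p : ℝ × ℝ} :
    p ∈ squareSet z ↔ ((z.1 : ℝ) - 1 / 2 ≤ p.1 ∧ p.1 ≤ z.1 + 1 / 2) ∧
      ((z.2 : ℝ) - 1 / 2 ≤ p.2 ∧ p.2 ≤ z.2 + 1 / 2) := by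
  simp only [squareSet, Set.mem_Icc, Prod.le_def]
  tauto

lemma squareCenter_mem_squareSet (z : GridV) : squareCenter z ∈ squareSet z := by
  rw [mem_squareSet]
  simp only [squareCenter]
  refine ⟨⟨?_, ?_⟩, ?_, ?_⟩ <;> linarith

lemma exists_mem_squareSet (p : ℝ × ℝ) : ∃ z, p ∈ squareSet z := by
  refine ⟨(round p.1, round p.2), ?_⟩
  have h1 := abs_le.1 (abs_sub_round p.1)
  have h2 := abs_le.1 (abs_sub_round p.2)
  rw [mem_squareSet]
  refine ⟨⟨?_, ?_⟩, ?_, ?_⟩ <;> dsimp only <;> linarith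

lemma mem_edgeSeg_hEdge {u : GridV} {p : ℝ × ℝ} :
    p ∈ edgeSeg (hEdge u) ↔
      p.2 = u.2 - 1 / 2 ∧ (u.1 : ℝ) - 1 / 2 ≤ p.1 ∧ p.1 ≤ u.1 + 1 / 2 := by
  have h : edgeSeg (hEdge u) = (fun x : ℝ => (x, (u.2 : ℝ) - 1 / 2)) ''
      segment ℝ ((u.1 : ℝ) - 1 / 2) (u.1 + 1 / 2) := by
    rw [Prod.image_mk_segment_left]
    simp only [edgeSeg, hEdge, toPlane, Sym2.lift_mk, Prod.fst_add, Prod.snd_add]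
    push_cast
    congr 2 <;> ring
  rw [h, segment_eq_Icc (by linarith)]
  constructor
  · rintro ⟨x, hx, rfl⟩
    exact ⟨rfl, hx.1, hx.2⟩
  · rintro ⟨h1, h2⟩
    exact ⟨p.1, h2, by rw [← h1]⟩

lemma mem_edgeSeg_vEdge {u : GridV} {p : ℝ × ℝ} :
    p ∈ edgeSeg (vEdge u) ↔
      p.1 = u.1 - 1 / 2 ∧ (u.2 : ℝ) - 1 / 2 ≤ p.2 ∧ p.2 ≤ u.2 + 1 / 2 := by
  have h : edgeSeg (vEdge u) = (fun x : ℝ => ((u.1 : ℝ) - 1 / 2, x)) ''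
      segment ℝ ((u.2 : ℝ) - 1 / 2) (u.2 + 1 / 2) := by
    rw [Prod.image_mk_segment_right]
    simp only [edgeSeg, vEdge, toPlane, Sym2.lift_mk, Prod.fst_add, Prod.snd_add]
    push_cast
    congr 2 <;> ring
  rw [h, segment_eq_Icc (by linarith)]
  constructor
  · rintro ⟨x, hx, rfl⟩
    exact ⟨rfl, hx.1, hx.2⟩
  · rintro ⟨h1, h2⟩
    exact ⟨p.2, h2, by rw [← h1]⟩

lemma edgeSeg_subset_squareSet {z : GridV} {e : Sym2 GridV} (h : e ∈ squareEdges z) :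
    edgeSeg e ⊆ squareSet z := by
  intro p hp
  rw [mem_squareSet]
  rcases mem_squareEdges.1 h with rfl | rfl | rfl | rfl <;>
    simp only [mem_edgeSeg_hEdge, mem_edgeSeg_vEdge, Prod.fst_add, Prod.snd_add] at hp <;>
    push_cast at hp <;> refine ⟨⟨?_, ?_⟩, ?_, ?_⟩ <;> linarith

/-- Points of the open square lie on no edge. -/
lemma notMem_edgeSeg_of_mem_openSquare {z w : GridV} {e : Sym2 GridV} (h : e ∈ squareEdges w)
    {p : ℝ × ℝ} (h1 : |p.1 - z.1| < 1 / 2) (h2 : |p.2 - z.2| < 1 / 2) : p ∉ edgeSeg e := by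
  rw [abs_lt] at h1 h2
  rcases eq_hEdge_or_eq_vEdge h with ⟨u, rfl⟩ | ⟨u, rfl⟩
  · rw [mem_edgeSeg_hEdge]
    rintro ⟨h3, -⟩
    have h4 : (z.2 : ℝ) < u.2 := by linarith
    have h5 : (u.2 : ℝ) < z.2 + 1 := by linarith
    norm_cast at h4 h5
    omega
  · rw [mem_edgeSeg_vEdge]
    rintro ⟨h3, -⟩
    have h4 : (z.1 : ℝ) < u.1 := by linarith
    have h5 : (u.1 : ℝ) < z.1 + 1 := by linarith
    norm_cast at h4 h5
    omega

/-- Every edge has a point, its midpoint, which lies on no other edge. -/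
lemma exists_mem_edgeSeg_unique {z : GridV} {e : Sym2 GridV} (h : e ∈ squareEdges z) :
    ∃ p ∈ edgeSeg e, ∀ w, ∀ e' ∈ squareEdges w, p ∈ edgeSeg e' → e' = e := by
  have key (a b : ℤ) (h1 : (b : ℝ) - 1 / 2 ≤ a) (h2 : (a : ℝ) ≤ b + 1 / 2) : b = a := by
    have h3 : (b : ℝ) < a + 1 := by linarith
    have h4 : (a : ℝ) < b + 1 := by linarith
    norm_cast at h3 h4
    omega
  have key' (a b : ℤ) (h : (a : ℝ) = b - 1 / 2) : False := by
    have h3 : (a : ℝ) < b := by linarith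
    have h4 : (b : ℝ) < a + 1 := by linarith
    norm_cast at h3 h4
    omega
  rcases eq_hEdge_or_eq_vEdge h with ⟨u, rfl⟩ | ⟨u, rfl⟩
  · refine ⟨((u.1 : ℝ), (u.2 : ℝ) - 1 / 2), ?_, fun w e' he' hp => ?_⟩
    · rw [mem_edgeSeg_hEdge]
      refine ⟨rfl, ?_, ?_⟩ <;> dsimp only <;> linarith
    · rcases eq_hEdge_or_eq_vEdge he' with ⟨v, rfl⟩ | ⟨v, rfl⟩
      · rw [mem_edgeSeg_hEdge] at hp
        obtain ⟨h1, h2, h3⟩ := hp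
        have h4 : (v.2 : ℝ) = u.2 := by dsimp only at h1; linarith
        exact hEdge_inj.2 (Prod.ext (key _ _ h2 h3) (by exact_mod_cast h4))
      · rw [mem_edgeSeg_vEdge] at hp
        exact (key' _ _ hp.1).elim
  · refine ⟨((u.1 : ℝ) - 1 / 2, (u.2 : ℝ)), ?_, fun w e' he' hp => ?_⟩
    · rw [mem_edgeSeg_vEdge]
      refine ⟨rfl, ?_, ?_⟩ <;> dsimp only <;> linarith
    · rcases eq_hEdge_or_eq_vEdge he' with ⟨v, rfl⟩ | ⟨v, rfl⟩
      · rw [mem_edgeSeg_hEdge] at hp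
        exact (key' _ _ hp.1).elim
      · rw [mem_edgeSeg_vEdge] at hp
        obtain ⟨h1, h2, h3⟩ := hp
        have h4 : (v.1 : ℝ) = u.1 := by dsimp only at h1; linarith
        exact vEdge_inj.2 (Prod.ext (by exact_mod_cast h4) (key _ _ h2 h3))

/-! ### Components of the complement of a set of edges -/

lemma squareCenter_notMem_carrierOf {E : Set (Sym2 GridV)} (hE : ∀ e ∈ E, ∃ z, e ∈ squareEdges z)
    (z : GridV) : squareCenter z ∉ carrierOf E := by
  simp only [carrierOf, Set.mem_iUnion, not_exists]
  intro e he
  obtain ⟨w, hw⟩ := hE e he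
  exact notMem_edgeSeg_of_mem_openSquare (z := z) hw (by simp [squareCenter])
    (by simp [squareCenter])

lemma connectedComponentIn_eq_squareCenter {E : Set (Sym2 GridV)}
    (hE : ∀ e ∈ E, ∃ z, e ∈ squareEdges z) {z : GridV} {p : ℝ × ℝ} (hp : p ∈ squareSet z)
    (hpE : p ∉ carrierOf E) :
    connectedComponentIn (carrierOf E)ᶜ p =
      connectedComponentIn (carrierOf E)ᶜ (squareCenter z) := by
  have hsub : segment ℝ (squareCenter z) p ⊆ (carrierOf E)ᶜ := by
    rw [segment_eq_image_lineMap]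
    rintro _ ⟨t, ⟨ht0, ht1⟩, rfl⟩
    rcases ht1.eq_or_lt with rfl | ht1
    · simpa using hpE
    · simp only [carrierOf, Set.mem_compl_iff, Set.mem_iUnion, not_exists]
      intro e he
      obtain ⟨w, hw⟩ := hE e he
      rw [mem_squareSet] at hp
      obtain ⟨⟨h1, h2⟩, h3, h4⟩ := hp
      have key (c x : ℝ) (hx : c - 1 / 2 ≤ x) (hx' : x ≤ c + 1 / 2) :
          |AffineMap.lineMap c x t - c| < 1 / 2 := by
        rw [AffineMap.lineMap_apply_ring', add_sub_cancel_right, abs_lt]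
        constructor <;> nlinarith
      refine notMem_edgeSeg_of_mem_openSquare (z := z) hw ?_ ?_
      · simpa [squareCenter, AffineMap.lineMap_apply] using key z.1 p.1 h1 h2
      · simpa [squareCenter, AffineMap.lineMap_apply] using key z.2 p.2 h3 h4
  have hconn : IsPreconnected (segment ℝ (squareCenter z) p) :=
    (convex_segment _ _).isPreconnected
  exact (connectedComponentIn_eq (hconn.subset_connectedComponentIn
    (left_mem_segment ℝ _ _) hsub (right_mem_segment ℝ _ _))).symm

lemma connectedComponentIn_squareCenter_eq {E : Set (Sym2 GridV)}
    (hE : ∀ e ∈ E, ∃ z, e ∈ squareEdges z) {a b : GridV} {e : Sym2 GridV}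
    (ha : e ∈ squareEdges a) (hb : e ∈ squareEdges b) (he : e ∉ E) :
    connectedComponentIn (carrierOf E)ᶜ (squareCenter a) =
      connectedComponentIn (carrierOf E)ᶜ (squareCenter b) := by
  obtain ⟨p, hp, huniq⟩ := exists_mem_edgeSeg_unique ha
  have hpE : p ∉ carrierOf E := by
    simp only [carrierOf, Set.mem_iUnion, not_exists]
    intro e' he' hp'
    obtain ⟨w, hw⟩ := hE e' he'
    exact he (huniq w e' hw hp' ▸ he')
  rw [← connectedComponentIn_eq_squareCenter hE (edgeSeg_subset_squareSet ha hp) hpE,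
    ← connectedComponentIn_eq_squareCenter hE (edgeSeg_subset_squareSet hb hp) hpE]

lemma inInterior_squareSet_iff {E : Set (Sym2 GridV)} (hE : ∀ e ∈ E, ∃ z, e ∈ squareEdges z)
    {z : GridV} : inInterior E (squareSet z) ↔ squareCenter z ∈ interiorOf E := by
  refine ⟨fun h => (h (squareCenter_mem_squareSet z)).resolve_right
    (squareCenter_notMem_carrierOf hE z), fun h p hp => ?_⟩
  by_cases hpE : p ∈ carrierOf E
  · exact .inr hpE
  · exact .inl ⟨hpE, by rw [connectedComponentIn_eq_squareCenter hE hp hpE]; exact h.2⟩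

lemma inExterior_squareSet_iff {E : Set (Sym2 GridV)} (hE : ∀ e ∈ E, ∃ z, e ∈ squareEdges z)
    {z : GridV} : inExterior E (squareSet z) ↔ squareCenter z ∈ exteriorOf E := by
  refine ⟨fun h => (h (squareCenter_mem_squareSet z)).resolve_right
    (squareCenter_notMem_carrierOf hE z), fun h p hp => ?_⟩
  by_cases hpE : p ∈ carrierOf E
  · exact .inr hpE
  · exact .inl ⟨hpE, by rw [connectedComponentIn_eq_squareCenter hE hp hpE]; exact h.2⟩

lemma squareCenter_mem_exteriorOf_of_edge {E : Set (Sym2 GridV)}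
    (hE : ∀ e ∈ E, ∃ z, e ∈ squareEdges z) {a b : GridV} {e : Sym2 GridV}
    (ha : e ∈ squareEdges a) (hb : e ∈ squareEdges b) (he : e ∉ E)
    (h : squareCenter a ∈ exteriorOf E) : squareCenter b ∈ exteriorOf E :=
  ⟨squareCenter_notMem_carrierOf hE b,
    by rw [← connectedComponentIn_squareCenter_eq hE ha hb he]; exact h.2⟩

lemma notMem_exteriorOf_of_mem_interiorOf {E : Set (Sym2 GridV)} {p : ℝ × ℝ}
    (h : p ∈ interiorOf E) : p ∉ exteriorOf E := fun h' => h'.2 h.2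

lemma isClosed_squareSet (z : GridV) : IsClosed (squareSet z) := isClosed_Icc

lemma isClosed_iUnion_squareSet (S : Set GridV) : IsClosed (⋃ z ∈ S, squareSet z) := by
  rw [Set.biUnion_eq_iUnion]
  refine LocallyFinite.isClosed_iUnion ?_ fun z => isClosed_squareSet _
  suffices h : LocallyFinite squareSet from h.comp_injective Subtype.val_injective
  intro p
  refine ⟨Metric.ball p 1, Metric.ball_mem_nhds p one_pos, ?_⟩
  refine Set.Finite.subset ((Set.finite_Icc (⌊p.1⌋ - 2) (⌊p.1⌋ + 2)).prod
    (Set.finite_Icc (⌊p.2⌋ - 2) (⌊p.2⌋ + 2))) ?_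
  rintro z ⟨q, hq, hqp⟩
  rw [mem_squareSet] at hq
  rw [Metric.mem_ball, Prod.dist_eq, max_lt_iff, Real.dist_eq, Real.dist_eq, abs_lt, abs_lt] at hqp
  obtain ⟨⟨h1, h2⟩, h3, h4⟩ := hq
  obtain ⟨⟨h5, h6⟩, h7, h8⟩ := hqp
  have key (a : ℤ) (x y : ℝ) (h1 : (a : ℝ) - 1 / 2 ≤ y) (h2 : y ≤ a + 1 / 2) (h3 : -1 < y - x)
      (h4 : y - x < 1) : a ∈ Set.Icc (⌊x⌋ - 2) (⌊x⌋ + 2) := by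
    have h5 := Int.floor_le x
    have h6 := Int.lt_floor_add_one x
    have h7 : (⌊x⌋ : ℝ) < a + 2 := by linarith
    have h8 : (a : ℝ) < ⌊x⌋ + 3 := by linarith
    norm_cast at h7 h8
    constructor <;> omega
  exact ⟨key _ _ _ h1 h2 h5 h6, key _ _ _ h3 h4 h7 h8⟩

/-- A point common to two squares, exactly one of which is in `S`, lies on the boundary of `S`. -/
lemma mem_carrierOf_cellBoundary {S : Set GridV} {a b : GridV} (ha : a ∈ S) (hb : b ∉ S)
    {p : ℝ × ℝ} (hpa : p ∈ squareSet a) (hpb : p ∈ squareSet b) :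
    p ∈ carrierOf (cellBoundary S) := by
  have horizontal : ∀ c d : GridV, c.2 = d.2 → c.1 < d.1 → p ∈ squareSet c → p ∈ squareSet d →
      ¬ (c ∈ S ↔ d ∈ S) → p ∈ carrierOf (cellBoundary S) := by
    intro c d h2 h1 hc hd hS
    rw [mem_squareSet] at hc hd
    have h3 : (d.1 : ℝ) < c.1 + 2 := by linarith
    have h4 : d.1 = c.1 + 1 := by norm_cast at h3; omega
    have h5 : c = d - (1, 0) := by ext <;> simp [h2, h4]
    simp only [carrierOf, Set.mem_iUnion]
    refine ⟨vEdge d, vEdge_mem_cellBoundary.2 (by rw [← h5]; tauto), mem_edgeSeg_vEdge.2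
      ⟨?_, hd.2⟩⟩
    have h6 : (d.1 : ℝ) = c.1 + 1 := by exact_mod_cast h4
    linarith
  have vertical : ∀ c d : GridV, c.1 = d.1 → c.2 < d.2 → p ∈ squareSet c → p ∈ squareSet d →
      ¬ (c ∈ S ↔ d ∈ S) → p ∈ carrierOf (cellBoundary S) := by
    intro c d h2 h1 hc hd hS
    rw [mem_squareSet] at hc hd
    have h3 : (d.2 : ℝ) < c.2 + 2 := by linarith
    have h4 : d.2 = c.2 + 1 := by norm_cast at h3; omega
    have h5 : c = d - (0, 1) := by ext <;> simp [h2, h4]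
    simp only [carrierOf, Set.mem_iUnion]
    refine ⟨hEdge d, hEdge_mem_cellBoundary.2 (by rw [← h5]; tauto), mem_edgeSeg_hEdge.2
      ⟨?_, hd.1⟩⟩
    have h6 : (d.2 : ℝ) = c.2 + 1 := by exact_mod_cast h4
    linarith
  have hpt : p ∈ squareSet (a.1, b.2) :=
    mem_squareSet.2 ⟨(mem_squareSet.1 hpa).1, (mem_squareSet.1 hpb).2⟩
  by_cases ht : (a.1, b.2) ∈ S
  · rcases lt_trichotomy a.1 b.1 with h | h | h
    · exact horizontal (a.1, b.2) b rfl h hpt hpb (by tauto)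
    · rw [h] at ht
      exact absurd ht hb
    · exact horizontal b (a.1, b.2) rfl h hpb hpt (by tauto)
  · rcases lt_trichotomy a.2 b.2 with h | h | h
    · exact vertical a (a.1, b.2) rfl h hpa hpt (by tauto)
    · exact absurd (h ▸ ha) ht
    · exact vertical (a.1, b.2) a rfl h hpt hpa (by tauto)

/-- The squares of a finite set whose boundary belongs to `E` are in the interior of `E`. -/
lemma squareCenter_mem_interiorOf {E : Set (Sym2 GridV)} (hE : ∀ e ∈ E, ∃ z, e ∈ squareEdges z)
    {S : Set GridV} (hS : S.Finite) (hSE : cellBoundary S ⊆ E) {z : GridV} (hz : z ∈ S) :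
    squareCenter z ∈ interiorOf E := by
  have hzE := squareCenter_notMem_carrierOf hE z
  refine ⟨hzE, ?_⟩
  set K := ⋃ z ∈ S, squareSet z with hK
  set L := ⋃ z ∈ Sᶜ, squareSet z with hL
  have hzK : squareCenter z ∈ K := Set.mem_biUnion hz (squareCenter_mem_squareSet z)
  have hKb : Bornology.IsBounded K :=
    (hS.isCompact_biUnion fun z _ => (isCompact_Icc : IsCompact (squareSet z))).isBounded
  refine hKb.subset ?_
  set T := connectedComponentIn (carrierOf E)ᶜ (squareCenter z) with hT
  have hTE : T ⊆ (carrierOf E)ᶜ := connectedComponentIn_subset _ _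
  have hcover : T ⊆ K ∪ L := by
    intro p _
    obtain ⟨w, hw⟩ := exists_mem_squareSet p
    by_cases h : w ∈ S
    · exact .inl (Set.mem_biUnion h hw)
    · exact .inr (Set.mem_biUnion h hw)
  have hdisj : T ∩ (K ∩ L) = ∅ := by
    rw [Set.eq_empty_iff_forall_notMem]
    rintro p ⟨hpT, hpK, hpL⟩
    simp only [hK, hL, Set.mem_iUnion] at hpK hpL
    obtain ⟨a, ha, hpa⟩ := hpK
    obtain ⟨b, hb, hpb⟩ := hpL
    exact hTE hpT (Set.biUnion_subset_biUnion_left hSE (mem_carrierOf_cellBoundary ha hb hpa hpb))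
  rcases isPreconnected_iff_subset_of_disjoint_closed.1 isPreconnected_connectedComponentIn K L
    (isClosed_iUnion_squareSet S) (isClosed_iUnion_squareSet Sᶜ) hcover hdisj with h | h
  · exact h
  · have hzT : squareCenter z ∈ T := mem_connectedComponentIn hzE
    exact absurd (show squareCenter z ∈ T ∩ (K ∩ L) from ⟨hzT, hzK, h hzT⟩) (by simp [hdisj])

/-! ### Cycles -/

lemma IsCycle.nonempty {E : Set (Sym2 GridV)} (hE : IsCycle E) : E.Nonempty := by
  obtain ⟨C, rfl⟩ := hE
  exact ⟨_, 0, rfl⟩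

lemma IsCycle.finite {E : Set (Sym2 GridV)} (hE : IsCycle E) : E.Finite := by
  obtain ⟨C, rfl⟩ := hE
  have : NeZero C.n := ⟨by have := C.hn; omega⟩
  have h : C.edgeSet = Set.range fun i => s(C.f i, C.f (i + 1)) := by
    ext e
    simp only [GridCycle.edgeSet, Set.mem_ofPred_eq, Set.mem_range, eq_comm]
  rw [h]
  exact Set.finite_range _

lemma GridCycle.mem_edgeSet_iff (C : GridCycle) (i : ZMod C.n) (u : GridV) :
    s(C.f i, u) ∈ C.edgeSet ↔ u = C.f (i + 1) ∨ u = C.f (i - 1) := by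
  simp only [GridCycle.edgeSet, Set.mem_ofPred_eq, Sym2.eq_iff]
  constructor
  · rintro ⟨j, ⟨h1, h2⟩ | ⟨h1, h2⟩⟩
    · exact .inl (by rw [h2, C.inj h1])
    · exact .inr (by rw [h2, C.inj h1, add_sub_cancel_right])
  · rintro (rfl | rfl)
    · exact ⟨i, .inl ⟨rfl, rfl⟩⟩
    · exact ⟨i - 1, .inr ⟨by rw [sub_add_cancel], rfl⟩⟩

lemma GridCycle.f_add_one_ne (C : GridCycle) (i : ZMod C.n) : C.f (i + 1) ≠ C.f (i - 1) := by
  intro h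
  have h1 : (2 : ZMod C.n) = 0 := by linear_combination C.inj h
  have h2 : ((2 : ℕ) : ZMod C.n) = 0 := by exact_mod_cast h1
  rw [ZMod.natCast_eq_zero_iff] at h2
  have := Nat.le_of_dvd two_pos h2
  have := C.hn
  omega

lemma GridCycle.adj_sub_one (C : GridCycle) (i : ZMod C.n) : GridAdj (C.f i) (C.f (i - 1)) := by
  have h := C.adj (i - 1)
  rw [sub_add_cancel] at h
  exact plusAdj.symm h

open Classical in
/-- The indicator, modulo two, of membership in an edge set. -/
noncomputable def edgeParity (E : Set (Sym2 GridV)) (e : Sym2 GridV) : ZMod 2 :=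
  if e ∈ E then 1 else 0

lemma edgeParity_of_notMem {E : Set (Sym2 GridV)} {e : Sym2 GridV} (h : e ∉ E) :
    edgeParity E e = 0 := if_neg h

lemma edgeParity_eq_zero_iff {E : Set (Sym2 GridV)} {e : Sym2 GridV} :
    edgeParity E e = 0 ↔ e ∉ E := by simp [edgeParity]

/-- Every vertex has even degree in a cycle. -/
lemma IsCycle.edgeParity_vertex {E : Set (Sym2 GridV)} (hE : IsCycle E) (v : GridV) :
    edgeParity E (hEdge v) + edgeParity E (hEdge (v - (1, 0))) + edgeParity E (vEdge v) +
      edgeParity E (vEdge (v - (0, 1))) = 0 := by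
  obtain ⟨C, rfl⟩ := hE
  have h1 : hEdge v = s(v, v + (1, 0)) := rfl
  have h2 : hEdge (v - (1, 0)) = s(v, v - (1, 0)) := by
    rw [hEdge, sub_add_cancel, Sym2.eq_swap]
  have h3 : vEdge v = s(v, v + (0, 1)) := rfl
  have h4 : vEdge (v - (0, 1)) = s(v, v - (0, 1)) := by
    rw [vEdge, sub_add_cancel, Sym2.eq_swap]
  rw [h1, h2, h3, h4]
  by_cases hv : ∃ i, C.f i = v
  · obtain ⟨i, rfl⟩ := hv
    have hne := C.f_add_one_ne i
    simp only [edgeParity, C.mem_edgeSet_iff]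
    have two : (1 : ZMod 2) + 1 = 0 := rfl
    rcases (C.adj i).cases with hp | hp | hp | hp <;>
      rcases (C.adj_sub_one i).cases with hq | hq | hq | hq <;>
      rw [hp, hq] at hne ⊢ <;>
      first
      | exact absurd rfl hne
      | simp [Prod.ext_iff, sub_eq_add_neg, two]
  · have hv' (u : GridV) : s(v, u) ∉ C.edgeSet := by
      rintro ⟨i, hi⟩
      rw [Sym2.eq_iff] at hi
      rcases hi with ⟨h, -⟩ | ⟨h, -⟩ <;> exact hv ⟨_, h.symm⟩
    simp [edgeParity_of_notMem (hv' _)]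

lemma IsCycle.exists_bound {E : Set (Sym2 GridV)} (hE : IsCycle E) :
    ∃ N : ℤ, ∀ x y : ℤ, N ≤ x → hEdge (x, y) ∉ E ∧ vEdge (x, y) ∉ E := by
  have hh : (hEdge ⁻¹' E).Finite := hE.finite.preimage fun a _ b _ h => hEdge_inj.1 h
  have hv : (vEdge ⁻¹' E).Finite := hE.finite.preimage fun a _ b _ h => vEdge_inj.1 h
  obtain ⟨N, hN⟩ := ((hh.union hv).image Prod.fst).bddAbove
  refine ⟨N + 1, fun x y hx => ⟨fun h => ?_, fun h => ?_⟩⟩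
  · have : x ≤ N := hN ⟨(x, y), .inl h, rfl⟩
    omega
  · have : x ≤ N := hN ⟨(x, y), .inr h, rfl⟩
    omega

/-- The squares can be coloured modulo two such that exactly the edges of a given cycle separate
squares of different colours. -/
lemma IsCycle.exists_coloring {E : Set (Sym2 GridV)} (hE : IsCycle E) :
    ∃ g : GridV → ZMod 2, ∀ a b e, a ≠ b → e ∈ squareEdges a → e ∈ squareEdges b →
      (g a = g b ↔ e ∉ E) := by
  obtain ⟨N, hN⟩ := hE.exists_bound
  let g : GridV → ZMod 2 := fun z => ∑ k ∈ Finset.Ioc z.1 N, edgeParity E (vEdge (k, z.2))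
  have hg0 (x y : ℤ) (hx : N ≤ x) : g (x, y) = 0 := by
    simp only [g]
    rw [Finset.Ioc_eq_empty (by omega), Finset.sum_empty]
  have hv (x y : ℤ) : g (x - 1, y) = edgeParity E (vEdge (x, y)) + g (x, y) := by
    rcases le_or_gt x N with hx | hx
    · have : Finset.Ioc (x - 1) N = insert x (Finset.Ioc x N) := by
        ext k
        simp only [Finset.mem_Ioc, Finset.mem_insert]
        omega
      simp only [g]
      rw [this, Finset.sum_insert (by simp)]
    · rw [hg0 _ _ (by omega), hg0 _ _ (by omega), edgeParity_of_notMem (hN x y hx.le).2, add_zero]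
  have hh (x y : ℤ) : g (x, y - 1) = edgeParity E (hEdge (x, y)) + g (x, y) := by
    rcases le_total N x with hx | hx
    · rw [hg0 _ _ hx, hg0 _ _ hx, edgeParity_of_notMem (hN x y hx).1, add_zero]
    · induction x, hx using Int.leInductionDown with
      | base =>
        rw [hg0 _ _ le_rfl, hg0 _ _ le_rfl, edgeParity_of_notMem (hN N y le_rfl).1, add_zero]
      | pred x _ ih =>
        have h := hE.edgeParity_vertex (x, y)
        simp only [Prod.mk_sub_mk, sub_zero] at h
        rw [hv, hv, ih]
        have two : (2 : ZMod 2) = 0 := rfl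
        linear_combination h - two * edgeParity E (hEdge (x - 1, y)) -
          two * edgeParity E (vEdge (x, y))
  refine ⟨g, fun a b e hab ha hb => ?_⟩
  rw [← edgeParity_eq_zero_iff]
  obtain ⟨⟨x, y⟩, ⟨rfl, h⟩ | ⟨rfl, h⟩⟩ := common_edge_cases hab ha hb
  · have := hh x y
    simp only [Prod.mk_sub_mk, sub_zero] at h
    rcases h with ⟨rfl, rfl⟩ | ⟨rfl, rfl⟩ <;> simp [this]
  · have := hv x y
    simp only [Prod.mk_sub_mk, sub_zero] at h
    rcases h with ⟨rfl, rfl⟩ | ⟨rfl, rfl⟩ <;> simp [this]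

/-- A finite nonempty set of grid edges with no dead ends contains a cycle. -/
lemma exists_isCycle_subset {G : Set (Sym2 GridV)} (hfin : G.Finite) (hne : G.Nonempty)
    (hadj : ∀ u v, s(u, v) ∈ G → GridAdj u v)
    (hnext : ∀ u v, s(u, v) ∈ G → ∃ w, w ≠ u ∧ s(v, w) ∈ G) : ∃ E ⊆ G, IsCycle E := by
  obtain ⟨e, he⟩ := hne
  induction e using Sym2.ind with | _ a b
  choose next hnext_ne hnext_mem using hnext
  let step : {d : GridV × GridV // s(d.1, d.2) ∈ G} → {d : GridV × GridV // s(d.1, d.2) ∈ G} :=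
    fun d => ⟨(d.1.2, next d.1.1 d.1.2 d.2), hnext_mem _ _ _⟩
  let v : ℕ → GridV := fun k => (step^[k] ⟨(a, b), he⟩).1.1
  have hv1 (k : ℕ) : v (k + 1) = (step^[k] ⟨(a, b), he⟩).1.2 := by
    simp only [v, Function.iterate_succ_apply']
    rfl
  have hmem (k : ℕ) : s(v k, v (k + 1)) ∈ G := by
    rw [hv1]
    exact (step^[k] ⟨(a, b), he⟩).2
  have hv2 (k : ℕ) : v (k + 2) ≠ v k := by
    rw [hv1 (k + 1), Function.iterate_succ_apply']
    exact hnext_ne _ _ _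
  have hrep : ∃ j, ∃ i < j, v i = v j := by
    have hinj : ¬ Function.Injective v := by
      intro hinj
      have hinf := Set.infinite_range_of_injective hinj
      have hfin' : {u | ∃ e ∈ G, u ∈ e}.Finite := by
        have : {u | ∃ e ∈ G, u ∈ e} = ⋃ e ∈ G, {u | u ∈ e} := by
          ext
          simp
        rw [this]
        refine hfin.biUnion fun e _ => ?_
        induction e using Sym2.ind with | _ x y
        exact (Set.toFinite {x, y}).subset fun u hu => by simpa using hu
      refine hinf (hfin'.subset ?_)
      rintro _ ⟨k, rfl⟩
      exact ⟨_, hmem k, Sym2.mem_mk_left _ _⟩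
    simp only [Function.Injective, not_forall] at hinj
    obtain ⟨i, j, hij, hne⟩ := hinj
    rcases Ne.lt_or_gt hne with h | h
    exacts [⟨j, i, h, hij⟩, ⟨i, j, h, hij.symm⟩]
  classical
  obtain ⟨i, hij, hvij⟩ := Nat.find_spec hrep
  set j := Nat.find hrep with hj
  have hinj (k l : ℕ) (hk : k < j) (hl : l < j) (h : v k = v l) : k = l := by
    rcases lt_trichotomy k l with hkl | hkl | hkl
    · exact absurd ⟨k, hkl, h⟩ (Nat.find_min hrep hl)
    · exact hkl
    · exact absurd ⟨l, hkl, h.symm⟩ (Nat.find_min hrep hk)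
  have h1 : j ≠ i + 1 := by
    intro h
    have := hadj _ _ (hmem i)
    rw [← h, ← hvij] at this
    simp [GridAdj] at this
  have h2 : j ≠ i + 2 := by
    intro h
    exact hv2 i (by rw [← h, hvij])
  have hn : 3 ≤ j - i := by omega
  have : NeZero (j - i) := ⟨by omega⟩
  have : Fact (1 < j - i) := ⟨by omega⟩
  let f : ZMod (j - i) → GridV := fun z => v (i + z.val)
  have hf (z : ZMod (j - i)) : f (z + 1) = v (i + z.val + 1) := by
    have hz := ZMod.val_lt z
    simp only [f, ZMod.val_add, ZMod.val_one]
    rcases eq_or_lt_of_le (show z.val + 1 ≤ j - i from hz) with h | h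
    · have h3 : i + z.val + 1 = j := by omega
      rw [h3, ← hvij, h, Nat.mod_self, add_zero]
    · rw [Nat.mod_eq_of_lt h, add_assoc]
  have hfmem (z : ZMod (j - i)) : s(f z, f (z + 1)) ∈ G := by
    rw [hf]
    exact hmem _
  let C : GridCycle := ⟨j - i, hn, f, fun z w h => ?_, fun z => hadj _ _ (hfmem z)⟩
  · refine ⟨C.edgeSet, ?_, C, rfl⟩
    rintro _ ⟨z, rfl⟩
    exact hfmem z
  · have hz := ZMod.val_lt z
    have hw := ZMod.val_lt w
    have := hinj _ _ (by omega) (by omega) h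
    exact ZMod.val_injective _ (by omega)

/-! ### Boundaries of sets of squares -/

lemma exists_mem_cellBoundary_next {S : Set GridV} {u v : GridV} (h : s(u, v) ∈ cellBoundary S) :
    ∃ w, w ≠ u ∧ s(v, w) ∈ cellBoundary S := by
  obtain ⟨a, ha, b, hb, hea, heb⟩ := id h
  have hadj : GridAdj v u := plusAdj.symm (gridAdj_of_mem_squareEdges hea)
  have h1 : s(v, v + (1, 0)) = hEdge v := rfl
  have h2 : s(v, v - (1, 0)) = hEdge (v - (1, 0)) := by
    rw [hEdge, sub_add_cancel, Sym2.eq_swap]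
  have h3 : s(v, v + (0, 1)) = vEdge v := rfl
  have h4 : s(v, v - (0, 1)) = vEdge (v - (0, 1)) := by
    rw [vEdge, sub_add_cancel, Sym2.eq_swap]
  have h5 : v - (1, 0) - (0, 1) = v - (0, 1) - (1, 0) := sub_right_comm _ _ _
  rw [Sym2.eq_swap] at h
  by_contra! hcon
  have c1 := hcon (v + (1, 0))
  have c2 := hcon (v - (1, 0))
  have c3 := hcon (v + (0, 1))
  have c4 := hcon (v - (0, 1))
  rw [h1, hEdge_mem_cellBoundary] at c1
  rw [h2, hEdge_mem_cellBoundary, h5] at c2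
  rw [h3, vEdge_mem_cellBoundary] at c3
  rw [h4, vEdge_mem_cellBoundary] at c4
  rcases hadj.cases with rfl | rfl | rfl | rfl
  · rw [h1, hEdge_mem_cellBoundary] at h
    replace c2 := c2 (by simp [Prod.ext_iff, sub_eq_add_neg])
    replace c3 := c3 (by simp [Prod.ext_iff])
    replace c4 := c4 (by simp [Prod.ext_iff, sub_eq_add_neg])
    tauto
  · rw [h2, hEdge_mem_cellBoundary, h5] at h
    replace c1 := c1 (by simp [Prod.ext_iff, sub_eq_add_neg])
    replace c3 := c3 (by simp [Prod.ext_iff, sub_eq_add_neg])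
    replace c4 := c4 (by simp [Prod.ext_iff, sub_eq_add_neg])
    tauto
  · rw [h3, vEdge_mem_cellBoundary] at h
    replace c1 := c1 (by simp [Prod.ext_iff])
    replace c2 := c2 (by simp [Prod.ext_iff, sub_eq_add_neg])
    replace c4 := c4 (by simp [Prod.ext_iff, sub_eq_add_neg])
    tauto
  · rw [h4, vEdge_mem_cellBoundary] at h
    replace c1 := c1 (by simp [Prod.ext_iff, sub_eq_add_neg])
    replace c2 := c2 (by simp [Prod.ext_iff, sub_eq_add_neg])
    replace c3 := c3 (by simp [Prod.ext_iff, sub_eq_add_neg])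
    tauto

lemma finite_squareEdges (z : GridV) : (squareEdges z).Finite := by
  unfold squareEdges
  exact Set.toFinite _

lemma finite_cellBoundary {S : Set GridV} (hS : S.Finite) : (cellBoundary S).Finite :=
  (hS.biUnion fun z _ => finite_squareEdges z).subset fun _ ⟨_, ha, _, _, hea, _⟩ =>
    Set.mem_biUnion ha hea

/-- A set of squares is connected if every colouring that is constant across
adjacent squares of the set is constant on it. -/
def CellsConnected (S : Set GridV) : Prop :=
  ∀ g : GridV → ZMod 2, (∀ a ∈ S, ∀ b ∈ S, plusAdj a b → g a = g b) →
    ∀ a ∈ S, ∀ b ∈ S, g a = g b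

/-- If a set of squares and its complement are connected, no cycle is a proper subset of its
boundary. -/
lemma IsCycle.eq_cellBoundary {S : Set GridV} {E : Set (Sym2 GridV)} (hE : IsCycle E)
    (hS : CellsConnected S) (hSc : CellsConnected Sᶜ) (hES : E ⊆ cellBoundary S) :
    E = cellBoundary S := by
  obtain ⟨g, hg⟩ := hE.exists_coloring
  have hconst (a b : GridV) (hab : a ∈ S ↔ b ∈ S) (h : plusAdj a b) : g a = g b := by
    obtain ⟨e, hea, heb⟩ := h.exists_edge
    have hne : a ≠ b := by
      rintro rfl
      simp [plusAdj] at h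
    rw [hg a b e hne hea heb]
    intro he
    obtain ⟨c, hc, d, hd, hec, hed⟩ := hES he
    have h1 := eq_or_eq_of_common_edge hne hea heb hec
    have h2 := eq_or_eq_of_common_edge hne hea heb hed
    grind
  have hgS := hS g fun a ha b hb => hconst a b (by tauto)
  have hgSc := hSc g fun a ha b hb => hconst a b (by simp only [Set.mem_compl_iff] at ha hb; tauto)
  obtain ⟨e₀, he₀⟩ := hE.nonempty
  obtain ⟨a₀, ha₀, b₀, hb₀, hea₀, heb₀⟩ := hES he₀
  refine hES.antisymm ?_
  rintro e ⟨a, ha, b, hb, hea, heb⟩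
  by_contra he
  have h1 : g a = g b := (hg a b e (fun h => hb (h ▸ ha)) hea heb).2 he
  have h2 : g a₀ = g b₀ := by rw [hgS a₀ ha₀ a ha, h1, hgSc b hb b₀ hb₀]
  exact (hg a₀ b₀ e₀ (fun h => hb₀ (h ▸ ha₀)) hea₀ heb₀).1 h2 he₀

/-- The boundary of a finite connected set of squares with connected complement is a cycle. -/
lemma isCycle_cellBoundary {S : Set GridV} (hfin : S.Finite) (hne : (cellBoundary S).Nonempty)
    (hS : CellsConnected S) (hSc : CellsConnected Sᶜ) : IsCycle (cellBoundary S) := by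
  obtain ⟨E, hES, hE⟩ := exists_isCycle_subset (finite_cellBoundary hfin) hne
    (fun u v ⟨_, _, _, _, h, _⟩ => gridAdj_of_mem_squareEdges h)
    (fun u v h => exists_mem_cellBoundary_next h)
  rwa [← hE.eq_cellBoundary hS hSc hES]

/-! ### The exterior of a finite set of squares -/

/-- A finite set of squares has a connected cofinite exterior. -/
lemma exists_exterior_cells {C : Set GridV} (hC : C.Finite) :
    ∃ U : Set GridV, Uᶜ.Finite ∧ C ⊆ Uᶜ ∧ (∀ a ∈ U, ∀ b, b ∉ C → plusAdj a b → b ∈ U) ∧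
      CellsConnected U := by
  obtain ⟨N, hN⟩ : ∃ N : ℤ, ∀ z ∈ C, |z.1| < N ∧ |z.2| < N := by
    obtain ⟨N, hN⟩ := (hC.image fun z : GridV => max |z.1| |z.2|).bddAbove
    refine ⟨N + 1, fun z hz => ?_⟩
    have h : max |z.1| |z.2| ≤ N := hN ⟨z, hz, rfl⟩
    rw [max_le_iff] at h
    omega
  let U : Set GridV := {z | Relation.ReflTransGen (fun a b => b ∉ C ∧ plusAdj a b) (N, N) z}
  have hclosed : ∀ a ∈ U, ∀ b, b ∉ C → plusAdj a b → b ∈ U :=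
    fun a ha b hb hab => Relation.ReflTransGen.tail ha ⟨hb, hab⟩
  have hout (z : GridV) (h : N ≤ |z.1| ∨ N ≤ |z.2|) : z ∉ C := fun hz => by
    have := hN z hz
    omega
  have hrow (y : ℤ) (hy : N ≤ |y|) (x x' : ℤ) (h : (x, y) ∈ U) : (x', y) ∈ U := by
    induction x' using Int.inductionOn' (b := x) with
    | zero => exact h
    | succ k _ ih => exact hclosed _ ih _ (hout _ (.inr hy)) (by simp [plusAdj])
    | pred k _ ih => exact hclosed _ ih _ (hout _ (.inr hy)) (by simp [plusAdj])
  have hcol (x : ℤ) (hx : N ≤ |x|) (y y' : ℤ) (h : (x, y) ∈ U) : (x, y') ∈ U := by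
    induction y' using Int.inductionOn' (b := y) with
    | zero => exact h
    | succ k _ ih => exact hclosed _ ih _ (hout _ (.inl hx)) (by simp [plusAdj])
    | pred k _ ih => exact hclosed _ ih _ (hout _ (.inl hx)) (by simp [plusAdj])
  have hbase : (N, N) ∈ U := Relation.ReflTransGen.refl
  have houtU (z : GridV) (h : N ≤ |z.1| ∨ N ≤ |z.2|) : z ∈ U := by
    obtain ⟨x, y⟩ := z
    rcases h with h | h
    · exact hcol x h N y (hrow N (le_abs_self N) N x hbase)
    · exact hrow y h N x (hcol N (le_abs_self N) N y hbase)
  refine ⟨U, ?_, ?_, hclosed, ?_⟩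
  · refine Set.Finite.subset ((Set.finite_Icc (-N) N).prod (Set.finite_Icc (-N) N)) fun z hz => ?_
    have h : ¬ (N ≤ |z.1| ∨ N ≤ |z.2|) := fun h => hz (houtU z h)
    push Not at h
    exact ⟨abs_le.1 h.1.le, abs_le.1 h.2.le⟩
  · intro z hz hzU
    rcases Relation.ReflTransGen.cases_tail hzU with h | ⟨_, _, h, -⟩
    · have := hN z hz
      rw [h] at this
      exact absurd this.1 (not_lt.2 (le_abs_self N))
    · exact h hz
  · intro g hg
    have key : ∀ z ∈ U, g z = g (N, N) := by
      intro z hz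
      induction hz with
      | refl => rfl
      | tail hab hbc ih => rw [← ih, hg _ hab _ (hab.tail hbc) hbc.2]
    intro a ha b hb
    rw [key a ha, key b hb]

/-- Filling the holes of a connected set of squares yields a connected set. -/
lemma CellsConnected.compl_exterior {C U : Set GridV} (hC : CellsConnected C) (hU : Uᶜ.Finite)
    (hCU : C ⊆ Uᶜ) (hclosed : ∀ a ∈ U, ∀ b, b ∉ C → plusAdj a b → b ∈ U) :
    CellsConnected Uᶜ := by
  intro g hg
  obtain ⟨N, hN⟩ := (hU.image Prod.fst).bddAbove
  have key (x : ℤ) : ∀ y, (x, y) ∈ Uᶜ → ∃ c ∈ C, g (x, y) = g c := by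
    rcases le_total (N + 1) x with hx | hx
    · intro y hy
      have : x ≤ N := hN ⟨_, hy, rfl⟩
      omega
    · induction x, hx using Int.leInductionDown with
      | base =>
        intro y hy
        have : N + 1 ≤ N := hN ⟨_, hy, rfl⟩
        omega
      | pred x _ ih =>
        intro y hy
        by_cases hyC : (x - 1, y) ∈ C
        · exact ⟨_, hyC, rfl⟩
        · have hadj : plusAdj (x, y) (x - 1, y) := by simp [plusAdj]
          have hxy : (x, y) ∈ Uᶜ := fun h => hy (hclosed _ h _ hyC hadj)
          obtain ⟨c, hc, hgc⟩ := ih y hxy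
          exact ⟨c, hc, by rw [← hgc, hg _ hxy _ hy hadj]⟩
  have hgC := hC g fun a ha b hb => hg a (hCU ha) b (hCU hb)
  intro a ha b hb
  obtain ⟨c, hc, hac⟩ := key a.1 a.2 ha
  obtain ⟨d, hd, hbd⟩ := key b.1 b.2 hb
  rw [hac, hbd, hgC c hc d hd]

/-- The exterior squares of `C` lie in the exterior of any set of edges of squares of `C`. -/
lemma squareCenter_mem_exteriorOf {C U : Set GridV} (hU : Uᶜ.Finite) (hCU : C ⊆ Uᶜ)
    (hconn : CellsConnected U) {E : Set (Sym2 GridV)} (hE : ∀ e ∈ E, ∃ c ∈ C, e ∈ squareEdges c)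
    {z : GridV} (hz : z ∈ U) : squareCenter z ∈ exteriorOf E := by
  classical
  have hE' : ∀ e ∈ E, ∃ c, e ∈ squareEdges c := fun e he => (hE e he).imp fun _ h => h.2
  let comp : GridV → Set (ℝ × ℝ) := fun w => connectedComponentIn (carrierOf E)ᶜ (squareCenter w)
  have hcomp (w : GridV) (hw : w ∈ U) : comp w = comp z := by
    have h := hconn (fun w => if comp w = comp z then 1 else 0) ?_ w hw z hz
    · by_contra hne
      simp [hne] at h
    · intro a ha b hb hab
      obtain ⟨e, hea, heb⟩ := hab.exists_edge
      have hne : a ≠ b := by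
        rintro rfl
        simp [plusAdj] at hab
      have he : e ∉ E := by
        intro he
        obtain ⟨c, hc, hec⟩ := hE e he
        rcases eq_or_eq_of_common_edge hne hea heb hec with rfl | rfl
        exacts [hCU hc ha, hCU hc hb]
      have : comp a = comp b := connectedComponentIn_squareCenter_eq hE' hea heb he
      simp only [this]
  refine ⟨squareCenter_notMem_carrierOf hE' z, fun hb => ?_⟩
  have hsub : squareCenter '' U ⊆ comp z := by
    rintro _ ⟨w, hw, rfl⟩
    rw [← hcomp w hw]
    exact mem_connectedComponentIn (squareCenter_notMem_carrierOf hE' w)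
  have hrange : Bornology.IsBounded (squareCenter '' Set.univ) := by
    rw [← Set.union_compl_self U, Set.image_union]
    exact (hb.subset hsub).union (hU.image _).isBounded
  obtain ⟨R, hR⟩ := hrange.exists_norm_le
  obtain ⟨n, hn⟩ := exists_nat_gt R
  have h1 := hR _ ⟨((n : ℤ), 0), trivial, rfl⟩
  have h2 := (norm_fst_le (squareCenter ((n : ℤ), 0))).trans h1
  simp only [squareCenter, Int.cast_natCast, Real.norm_natCast] at h2
  linarith

/-! ### The plus-connected component -/

lemma cellsConnected_plusComp (ω : GridV → Prop) : CellsConnected (plusComp ω) := by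
  intro g hg
  have key : ∀ z ∈ plusComp ω, g z = g (0, 0) := by
    rintro z ⟨-, hz⟩
    induction hz with
    | refl => rfl
    | tail hab hbc ih =>
      rw [← ih, hg _ ⟨hbc.1, hab⟩ _ ⟨hbc.2.1, hab.tail hbc⟩ hbc.2.2]
  intro a ha b hb
  rw [key a ha, key b hb]

lemma vacant_of_plusAdj_plusComp {ω : GridV → Prop} {a b : GridV} (ha : a ∈ plusComp ω)
    (hb : b ∉ plusComp ω) (hab : plusAdj a b) : ¬ ω b :=
  fun h => hb ⟨h, ha.2.tail ⟨ha.1, h, hab⟩⟩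

/-- If the plus-connected occupied component `C⁺(0)` is finite and
nonempty, the outermost boundary `∂⁺₀` of `C⁺(0)` is a unique cycle `C⁺_out` of `G⁺_C`
such that: (i) all squares of `C⁺(0)` are contained in its interior; (ii) every one of
its edges is a boundary edge adjacent to an occupied square of `C⁺(0)` in its interior
and to a vacant square in its exterior. -/
theorem plus_outermost_boundary_cycle (ω : GridV → Prop)
    (hfin : (plusComp ω).Finite) (hne : (plusComp ω).Nonempty) :
    ∃ E : Set (Sym2 GridV),
      (IsCycleIn (gpcEdges ω) E ∧
        (∀ z ∈ plusComp ω, inInterior E (squareSet z)) ∧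
        (∀ e ∈ E,
          (∃ w ∈ plusComp ω, e ∈ squareEdges w ∧ inInterior E (squareSet w)) ∧
          (∃ w, ¬ ω w ∧ e ∈ squareEdges w ∧ inExterior E (squareSet w)))) ∧
      (∀ e, outermostBoundaryEdgeIn (gpcEdges ω) e ↔ e ∈ E) ∧
      (∀ E', IsCycleIn (gpcEdges ω) E' →
        (∀ z ∈ plusComp ω, inInterior E' (squareSet z)) →
        (∀ e ∈ E',
          (∃ w ∈ plusComp ω, e ∈ squareEdges w ∧ inInterior E' (squareSet w)) ∧
          (∃ w, ¬ ω w ∧ e ∈ squareEdges w ∧ inExterior E' (squareSet w))) →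
        E' = E) := by
  set C := plusComp ω
  obtain ⟨U, hU, hCU, hclosed, hconn⟩ := exists_exterior_cells hfin
  have hFconn : CellsConnected Uᶜ :=
    (cellsConnected_plusComp ω).compl_exterior hU hCU hclosed
  have hmemC {a b : GridV} (ha : a ∉ U) (hb : b ∈ U) (hab : plusAdj a b) : a ∈ C := by
    by_contra haC
    exact ha (hclosed b hb a haC hab.symm)
  have hG : ∀ E ⊆ gpcEdges ω, ∀ e ∈ E, ∃ c ∈ C, e ∈ squareEdges c := fun E hE e he => by
    simpa only [gpcEdges, Set.mem_iUnion, exists_prop] using hE he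
  have hG' : ∀ E ⊆ gpcEdges ω, ∀ e ∈ E, ∃ c, e ∈ squareEdges c :=
    fun E hE e he => (hG E hE e he).imp fun _ h => h.2
  have hext : ∀ E ⊆ gpcEdges ω, ∀ z ∈ U, squareCenter z ∈ exteriorOf E :=
    fun E hE z hz => squareCenter_mem_exteriorOf hU hCU hconn (hG E hE) hz
  have hbdry : ∀ e ∈ cellBoundary Uᶜ, ∃ a ∈ C, ∃ b ∈ U, plusAdj a b ∧ e ∈ squareEdges a ∧
      e ∈ squareEdges b := by
    rintro e ⟨a, ha, b, hb, hea, heb⟩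
    have hab := plusAdj_of_common_edge (fun h : a = b => hb (h ▸ ha)) hea heb
    rw [Set.notMem_compl_iff] at hb
    exact ⟨a, hmemC ha hb hab, b, hb, hab, hea, heb⟩
  have hsub : cellBoundary Uᶜ ⊆ gpcEdges ω := fun e he => by
    obtain ⟨a, ha, -, -, -, hea, -⟩ := hbdry e he
    exact Set.mem_biUnion ha hea
  have hint : ∀ z ∈ C, squareCenter z ∈ interiorOf (cellBoundary Uᶜ) := fun z hz =>
    squareCenter_mem_interiorOf (hG' _ hsub) hU subset_rfl (hCU hz)
  have hnonempty : (cellBoundary Uᶜ).Nonempty := by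
    by_contra! hempty
    obtain ⟨c, hc⟩ := hne
    have h := (hint c hc).2
    rw [hempty] at h
    simp only [carrierOf, Set.mem_empty_iff_false, Set.iUnion_of_empty, Set.iUnion_empty,
      Set.compl_empty, connectedComponentIn_univ,
      PreconnectedSpace.connectedComponent_eq_univ] at h
    exact NormedSpace.unbounded_univ ℝ (ℝ × ℝ) h
  have hcycle : IsCycle (cellBoundary Uᶜ) :=
    isCycle_cellBoundary hU hnonempty hFconn (by rwa [compl_compl])
  refine ⟨cellBoundary Uᶜ, ⟨⟨hcycle, hsub⟩, ?_, ?_⟩, ?_, ?_⟩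
  · exact fun z hz => (inInterior_squareSet_iff (hG' _ hsub)).2 (hint z hz)
  · intro e he
    obtain ⟨a, ha, b, hb, hab, hea, heb⟩ := hbdry e he
    exact ⟨⟨a, ha, hea, (inInterior_squareSet_iff (hG' _ hsub)).2 (hint a ha)⟩,
      b, vacant_of_plusAdj_plusComp ha (fun h => hCU h hb) hab, heb,
      (inExterior_squareSet_iff (hG' _ hsub)).2 (hext _ hsub b hb)⟩
  · refine fun e => ⟨fun ⟨heG, he⟩ => ?_, fun he => ⟨hsub he, fun E hE => .inr ?_⟩⟩
    · refine (he _ ⟨hcycle, hsub⟩).elim id fun hexte => ?_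
      by_contra he'
      obtain ⟨w, hw, hew⟩ := hG _ subset_rfl e heG
      obtain ⟨p, hp, huniq⟩ := exists_mem_edgeSeg_unique hew
      have hpE : p ∉ carrierOf (cellBoundary Uᶜ) := by
        simp only [carrierOf, Set.mem_iUnion, not_exists]
        intro e' he'' hp'
        obtain ⟨w', hw'⟩ := hG' _ hsub e' he''
        exact he' (huniq w' e' hw' hp' ▸ he'')
      have hpint := (inInterior_squareSet_iff (hG' _ hsub)).2 (hint w hw)
        (edgeSeg_subset_squareSet hew hp)
      exact notMem_exteriorOf_of_mem_interiorOf (hpint.resolve_right hpE)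
        ((hexte hp).resolve_right hpE)
    · obtain ⟨a, ha, b, hb, hab, hea, heb⟩ := hbdry e he
      exact (edgeSeg_subset_squareSet heb).trans
        ((inExterior_squareSet_iff (hG' _ hE.2)).2 (hext _ hE.2 b hb))
  · rintro E' ⟨hE'cycle, hE'sub⟩ hE'int hE'bdry
    refine hE'cycle.eq_cellBoundary hFconn (by rwa [compl_compl]) fun e he => ?_
    have hE'g := hG' _ hE'sub
    obtain ⟨⟨v, hv, hev, -⟩, w, hw, hew, hwext⟩ := hE'bdry e he
    rw [inExterior_squareSet_iff hE'g] at hwext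
    suffices hwU : w ∈ U from ⟨v, hCU hv, w, fun h => h hwU, hev, hew⟩
    by_contra hwU
    have hCext {a : GridV} (ha : a ∈ C) : squareCenter a ∉ exteriorOf E' :=
      notMem_exteriorOf_of_mem_interiorOf ((inInterior_squareSet_iff hE'g).1 (hE'int a ha))
    refine notMem_exteriorOf_of_mem_interiorOf (squareCenter_mem_interiorOf hE'g
      (S := {z | z ∈ Uᶜ ∧ squareCenter z ∈ exteriorOf E'}) (hU.subset fun z hz => hz.1) ?_
      ⟨hwU, hwext⟩) hwext
    rintro e' ⟨a, ⟨haU, haext⟩, b, hb, hea, heb⟩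
    by_contra he'
    have hbext := squareCenter_mem_exteriorOf_of_edge hE'g hea heb he' haext
    have hbU : b ∈ U := by
      by_contra hbU
      exact hb ⟨hbU, hbext⟩
    have hab := plusAdj_of_common_edge (fun h : a = b => haU (h ▸ hbU)) hea heb
    exact hCext (hmemC haU hbU hab) haext
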